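/- Let K₁, K₂, t be positive integers with t < K = K₁K₂, let Q be the MN PDA of Construction 1 on [K] with parameter t, and for k₁ ∈ [K₁] let Q⁽ᵏ¹⁾ be the restriction of Q to the block of columns B_{k₁} = {(k₁−1)K₂+1, …, k₁K₂}. Then Q⁽ᵏ¹⁾ satisfies conditions C1 (each column has exactly C(K−1,t−1) stars) and C3, and the set of integers appearing in Q⁽ᵏ¹⁾ is exactly { S : S a (t+1)-element subset of [K] with S ∩ B_{k₁} ≠ ∅ }, whose cardinality is C(K, t+1) − C(K−K₂, t+1). Hence Q⁽ᵏ¹⁾ is a (K₂, C(K,t), C(K−1,t−1), C(K,t+1) − C(K−K₂,t+1)) PDA with this integer alphabet. -/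

import Mathlib

/-- The number of `t`-element subsets of a finite type that contain a given element. -/
theorem card_filter_card_eq_and_mem {α : Type*} [Fintype α] [DecidableEq α] (a : α) {t : ℕ}
    (ht : 0 < t) :
    (Finset.univ.filter fun T : Finset α => T.card = t ∧ a ∈ T).card =
      (Fintype.card α - 1).choose (t - 1) := by
  rw [← Finset.card_univ, ← Finset.card_erase_of_mem (Finset.mem_univ a),
    ← Finset.card_powersetCard]
  refine Finset.card_nbij' (fun T => T.erase a) (fun T => insert a T) ?_ ?_ ?_ ?_
  · intro T hT
    simp only [Finset.coe_filter, Finset.mem_univ, true_and, Set.mem_ofPred_eq] at hT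
    simp only [Finset.mem_coe, Finset.mem_powersetCard]
    exact ⟨Finset.erase_subset_erase a (Finset.subset_univ T),
      by rw [Finset.card_erase_of_mem hT.2, hT.1]⟩
  · intro T hT
    simp only [Finset.mem_coe, Finset.mem_powersetCard] at hT
    have ha : a ∉ T := fun h => Finset.notMem_erase a _ (hT.1 h)
    simp only [Finset.coe_filter, Finset.mem_univ, true_and, Set.mem_ofPred_eq]
    refine ⟨?_, Finset.mem_insert_self a T⟩
    rw [Finset.card_insert_of_notMem ha, hT.2]
    omega
  · intro T hT
    simp only [Finset.coe_filter, Finset.mem_univ, true_and, Set.mem_ofPred_eq] at hT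
    exact Finset.insert_erase hT.2
  · intro T hT
    simp only [Finset.mem_coe, Finset.mem_powersetCard] at hT
    exact Finset.erase_insert fun h => Finset.notMem_erase a _ (hT.1 h)

/-- The number of `m`-element subsets of a finite type that meet the range of an injection. -/
theorem card_filter_card_eq_and_exists_mem {α β : Type*} [Fintype α] [DecidableEq α] [Fintype β]
    {f : β → α} (hf : Function.Injective f) (m : ℕ)
    [DecidablePred fun S : Finset α => S.card = m ∧ ∃ b, f b ∈ S] :
    (Finset.univ.filter fun S : Finset α => S.card = m ∧ ∃ b, f b ∈ S).card =
      (Fintype.card α).choose m - (Fintype.card α - Fintype.card β).choose m := by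
  have hB : (Finset.univ.image f)ᶜ.card = Fintype.card α - Fintype.card β := by
    rw [Finset.card_compl, Finset.card_image_of_injective _ hf, Finset.card_univ]
  rw [← hB, ← Finset.card_univ (α := α), ← Finset.card_powersetCard, ← Finset.card_powersetCard,
    ← Finset.card_sdiff_of_subset (Finset.powersetCard_mono (Finset.subset_univ _))]
  congr 1
  ext S
  simp only [Finset.mem_filter, Finset.mem_univ, true_and, Finset.mem_sdiff,
    Finset.mem_powersetCard, Finset.subset_iff, implies_true, Finset.mem_compl,
    Finset.mem_image, not_exists]
  constructor
  · rintro ⟨hS, b, hb⟩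
    exact ⟨hS, fun h => h.1 hb b rfl⟩
  · rintro ⟨hS, h⟩
    refine ⟨hS, ?_⟩
    by_contra! hn
    exact h ⟨fun x hx b hb => hn b (hb ▸ hx), hS⟩

/-- Let `K₁, K₂, t` be positive integers with `t < K = K₁K₂`, let `Q` be the
MN PDA of Construction 1 on `[K]` with parameter `t`, and for `k₁ ∈ [K₁]` let `Q^{(k₁)}` be
the restriction of `Q` to the block of columns `B_{k₁} = {(k₁−1)K₂+1, …, k₁K₂}` (0-indexed:
column `e k₁ k₂ = k₁·K₂ + k₂` for `k₂ ∈ [K₂]`). Then `Q^{(k₁)}` satisfies C1 (each column has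
exactly `C(K−1,t−1)` stars) and C3, and its set of integer entries is exactly the set of
`(t+1)`-element subsets `S` of `[K]` with `S ∩ B_{k₁} ≠ ∅`, of cardinality
`C(K,t+1) − C(K−K₂,t+1)`; hence `Q^{(k₁)}` is a
`(K₂, C(K,t), C(K−1,t−1), C(K,t+1) − C(K−K₂,t+1))` PDA with this integer alphabet. -/
theorem mn_pda_column_block (K₁ K₂ t : ℕ)
    (hK₁ : 0 < K₁) (hK₂ : 0 < K₂) (ht : 0 < t) (htK : t < K₁ * K₂)
    (Q : Finset (Fin (K₁ * K₂)) → Fin (K₁ * K₂) → Option (Finset (Fin (K₁ * K₂))))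
    (hQ : ∀ (T : Finset (Fin (K₁ * K₂))) (k : Fin (K₁ * K₂)),
      Q T k = if k ∈ T then none else some (insert k T))
    (e : Fin K₁ → Fin K₂ → Fin (K₁ * K₂))
    (he : ∀ (k₁ : Fin K₁) (k₂ : Fin K₂), (e k₁ k₂ : ℕ) = k₁.val * K₂ + k₂.val) :
    ∀ k₁ : Fin K₁,
      -- C1: each column of Q^{(k₁)} has exactly C(K−1,t−1) stars
      (∀ k₂ : Fin K₂,
        (Finset.univ.filter fun T : Finset (Fin (K₁ * K₂)) =>
          T.card = t ∧ Q T (e k₁ k₂) = none).card = (K₁ * K₂ - 1).choose (t - 1)) ∧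
      -- C3 within the block
      (∀ (T₁ T₂ : Finset (Fin (K₁ * K₂))) (k₂ k₂' : Fin K₂) (S : Finset (Fin (K₁ * K₂))),
        T₁.card = t → T₂.card = t → (T₁, k₂) ≠ (T₂, k₂') →
        Q T₁ (e k₁ k₂) = some S → Q T₂ (e k₁ k₂') = some S →
        T₁ ≠ T₂ ∧ k₂ ≠ k₂' ∧ Q T₁ (e k₁ k₂') = none ∧ Q T₂ (e k₁ k₂) = none) ∧
      -- the set of integers appearing in Q^{(k₁)} is exactly
      -- {S : |S| = t+1, S ∩ B_{k₁} ≠ ∅}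
      (∀ S : Finset (Fin (K₁ * K₂)),
        (∃ (T : Finset (Fin (K₁ * K₂))) (k₂ : Fin K₂), T.card = t ∧ Q T (e k₁ k₂) = some S)
          ↔ (S.card = t + 1 ∧ ∃ k₂ : Fin K₂, e k₁ k₂ ∈ S)) ∧
      -- whose cardinality is C(K,t+1) − C(K−K₂,t+1)
      (Finset.univ.filter fun S : Finset (Fin (K₁ * K₂)) =>
          S.card = t + 1 ∧ ∃ k₂ : Fin K₂, e k₁ k₂ ∈ S).card
        = (K₁ * K₂).choose (t + 1) - (K₁ * K₂ - K₂).choose (t + 1) := by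
  intro k₁
  have hinj : Function.Injective (e k₁) := fun a b hab => by
    have h := congrArg Fin.val hab
    rw [he, he] at h
    exact Fin.ext (by omega)
  have hnone : ∀ T k, Q T k = none ↔ k ∈ T := fun T k => by
    rw [hQ]; split_ifs with h <;> simp [h]
  have hsome : ∀ T k S, Q T k = some S ↔ k ∉ T ∧ insert k T = S := fun T k S => by
    rw [hQ]; split_ifs with h <;> simp [h]
  refine ⟨fun k₂ => ?_, ?_, fun S => ⟨?_, ?_⟩, ?_⟩
  · simp only [hnone]
    simpa using card_filter_card_eq_and_mem (e k₁ k₂) ht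
  · intro T₁ T₂ k₂ k₂' S _ _ hne h₁ h₂
    rw [hsome] at h₁ h₂
    rw [hnone, hnone]
    obtain ⟨hn₁, rfl⟩ := h₁
    obtain ⟨hn₂, hS⟩ := h₂
    have hk : k₂ ≠ k₂' := by
      rintro rfl
      refine hne (Prod.ext ?_ rfl)
      rw [← Finset.erase_insert hn₁, ← hS, Finset.erase_insert hn₂]
    have hek : e k₁ k₂ ≠ e k₁ k₂' := hinj.ne hk
    have hm₁ : e k₁ k₂' ∈ T₁ := Finset.mem_of_mem_insert_of_ne
      (hS ▸ Finset.mem_insert_self _ _) hek.symm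
    have hm₂ : e k₁ k₂ ∈ T₂ := Finset.mem_of_mem_insert_of_ne
      (hS.symm ▸ Finset.mem_insert_self _ _) hek
    exact ⟨fun h => hn₁ (h ▸ hm₂), hk, hm₁, hm₂⟩
  · rintro ⟨T, k₂, hT, h⟩
    obtain ⟨hn, rfl⟩ := (hsome _ _ _).1 h
    exact ⟨by rw [Finset.card_insert_of_notMem hn, hT], k₂, Finset.mem_insert_self _ _⟩
  · rintro ⟨hS, k₂, hk⟩
    exact ⟨S.erase (e k₁ k₂), k₂, by rw [Finset.card_erase_of_mem hk, hS, Nat.add_sub_cancel],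
      (hsome _ _ _).2 ⟨Finset.notMem_erase _ _, Finset.insert_erase hk⟩⟩
  · simpa only [Fintype.card_fin] using card_filter_card_eq_and_exists_mem hinj (t + 1)
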